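/- For all sufficiently large n, every K_{2,4}-saturated n by n bipartite graph has at least 4n - 4 edges, and this is tight: sat(K_{n,n}, K_{2,4}) = 4n - 4. -/

import Mathlib

open Finset

/-- An `n` by `n` bipartite graph, given by its edge set `E ⊆ U × U'`,
contains a copy of the complete bipartite graph with `a` vertices in `U`
and `b` vertices in `U'`. -/
def ContainsK (n : ℕ) (E : Finset (Fin n × Fin n)) (a b : ℕ) : Prop :=
  ∃ S T : Finset (Fin n), S.card = a ∧ T.card = b ∧ ∀ u ∈ S, ∀ v ∈ T, (u, v) ∈ E

/-- Contains an (unordered) copy of `K_{s,t}`. -/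
def ContainsKst (n : ℕ) (E : Finset (Fin n × Fin n)) (s t : ℕ) : Prop :=
  ContainsK n E s t ∨ ContainsK n E t s

/-- `K_{s,t}`-saturated: `K_{s,t}`-free, but adding any missing edge across
the bipartition creates a copy of `K_{s,t}`. -/
def SaturatedKst (n : ℕ) (E : Finset (Fin n × Fin n)) (s t : ℕ) : Prop :=
  ¬ ContainsKst n E s t ∧
    ∀ u v : Fin n, (u, v) ∉ E → ContainsKst n (insert (u, v) E) s t

/-- Degree of a vertex `u` on the `U` side. -/
def degU (n : ℕ) (E : Finset (Fin n × Fin n)) (u : Fin n) : ℕ :=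
  (E.filter (fun p => p.1 = u)).card

/-- Degree of a vertex `v` on the `U'` side. -/
def degV (n : ℕ) (E : Finset (Fin n × Fin n)) (v : Fin n) : ℕ :=
  (E.filter (fun p => p.2 = v)).card

open Classical in
/-- Neighbourhood of `u` in the bipartite graph given by the relation `R`. -/
noncomputable def nb {n : ℕ} (R : Fin n → Fin n → Prop) (u : Fin n) : Finset (Fin n) :=
  univ.filter (fun v => R u v)

lemma mem_nb {n : ℕ} {R : Fin n → Fin n → Prop} {u v : Fin n} : v ∈ nb R u ↔ R u v := by
  simp [nb]

/-- The same graph with the two sides exchanged. -/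
def op {n : ℕ} (R : Fin n → Fin n → Prop) : Fin n → Fin n → Prop := fun v u => R u v

lemma mem_nb_op {n : ℕ} {R : Fin n → Fin n → Prop} {u v : Fin n} : u ∈ nb (op R) v ↔ R u v :=
  mem_nb (R := op R)

lemma op_op {n : ℕ} (R : Fin n → Fin n → Prop) : op (op R) = R := rfl

/-- Local form of being saturated. -/
structure Sat {n : ℕ} (R : Fin n → Fin n → Prop) : Prop where
  free1 : ∀ u u', u ≠ u' → (nb R u ∩ nb R u').card ≤ 3
  free2 : ∀ v v', v ≠ v' → (nb (op R) v ∩ nb (op R) v').card ≤ 3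
  sat : ∀ u v, ¬ R u v →
    (∃ u2, R u2 v ∧ 3 ≤ (nb R u ∩ nb R u2).card) ∨
    (∃ v2, R u v2 ∧ 3 ≤ (nb (op R) v ∩ nb (op R) v2).card)

lemma Sat.swap {n : ℕ} {R : Fin n → Fin n → Prop} (h : Sat R) : Sat (op R) where
  free1 := h.free2
  free2 := h.free1
  sat := fun u v huv => (h.sat v u huv).symm

lemma double_count {n : ℕ} (R : Fin n → Fin n → Prop) (A B : Finset (Fin n)) :
    ∑ u ∈ A, (nb R u ∩ B).card = ∑ v ∈ B, (nb (op R) v ∩ A).card := by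
  classical
  have h1 : ∀ u, (nb R u ∩ B).card = ∑ v ∈ B, if R u v then 1 else 0 := by
    intro u
    rw [← Finset.card_filter]
    congr 1
    ext v
    simp [mem_nb, and_comm]
  have h2 : ∀ v, (nb (op R) v ∩ A).card = ∑ u ∈ A, if R u v then 1 else 0 := by
    intro v
    rw [← Finset.card_filter]
    congr 1
    ext u
    simp [mem_nb_op, and_comm]
  simp only [h1, h2]
  exact Finset.sum_comm

lemma edge_count {n : ℕ} (R : Fin n → Fin n → Prop) :
    ∑ u, (nb R u).card = ∑ v, (nb (op R) v).card := by
  simpa using double_count R univ univ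

lemma cover_count {n : ℕ} (R : Fin n → Fin n → Prop) (A B : Finset (Fin n))
    (h : ∀ a ∈ A, ∃ b ∈ B, R a b) : A.card ≤ ∑ b ∈ B, (nb (op R) b ∩ A).card := by
  rw [← double_count]
  calc A.card = ∑ a ∈ A, 1 := by simp
    _ ≤ _ := Finset.sum_le_sum (fun a ha => by
      obtain ⟨b, hb, hab⟩ := h a ha
      exact Finset.card_pos.mpr ⟨b, by simp [mem_nb, hb, hab]⟩)

lemma card_inter_compl_add {n : ℕ} (S T : Finset (Fin n)) :
    (S ∩ T).card + (S ∩ Tᶜ).card = S.card := by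
  rw [← Finset.sdiff_eq_inter_compl]
  exact Finset.card_inter_add_card_sdiff S T

/-- Every vertex has a neighbour. -/
lemma deg_pos {n : ℕ} {R : Fin n → Fin n → Prop} (h : Sat R) (u : Fin n) :
    1 ≤ (nb R u).card := by
  by_contra hc
  have h0 : nb R u = ∅ := by
    rw [← Finset.card_eq_zero]; omega
  have hno : ∀ v, ¬ R u v := fun v hv => by
    have := mem_nb.mpr hv
    simp [h0] at this
  rcases h.sat u u (hno u) with ⟨u2, _, h3⟩ | ⟨v2, hv2, _⟩
  · simp [h0] at h3
  · exact hno _ hv2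

/-- Common count for low degree vertices. -/
lemma low_count {n : ℕ} {R : Fin n → Fin n → Prop} (h : Sat R) (u : Fin n)
    (hd : (nb R u).card ≤ 2) (v : Fin n) (hv : v ∉ nb R u) :
    ∃ v2 ∈ nb R u, 3 ≤ (nb (op R) v ∩ nb (op R) v2).card := by
  rcases h.sat u v (fun hh => hv (mem_nb.mpr hh)) with ⟨u2, _, h3⟩ | ⟨v2, hv2, h3⟩
  · have := Finset.card_le_card (Finset.inter_subset_left (s₁ := nb R u) (s₂ := nb R u2))
    omega
  · exact ⟨v2, mem_nb.mpr hv2, h3⟩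

lemma low_sum {n : ℕ} {R : Fin n → Fin n → Prop} (h : Sat R) (u : Fin n)
    (hd : (nb R u).card ≤ 2) (k : ℕ) (hk : ∀ w, k ≤ (nb R w).card) :
    3 * (n - (nb R u).card) + k * (((nb R u).biUnion (nb (op R)))ᶜ).card
      ≤ ∑ v ∈ (nb R u)ᶜ, (nb (op R) v).card := by
  set P := nb R u with hP
  set U1 := P.biUnion (nb (op R)) with hU1
  have e1 : ∑ v ∈ Pᶜ, (nb (op R) v).card
      = ∑ v ∈ Pᶜ, (nb (op R) v ∩ U1).card + ∑ v ∈ Pᶜ, (nb (op R) v ∩ U1ᶜ).card := by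
    rw [← Finset.sum_add_distrib]
    exact Finset.sum_congr rfl (fun v _ => (card_inter_compl_add _ _).symm)
  have e2 : 3 * (n - P.card) ≤ ∑ v ∈ Pᶜ, (nb (op R) v ∩ U1).card := by
    calc 3 * (n - P.card) = ∑ v ∈ Pᶜ, 3 := by simp [Finset.card_compl, mul_comm]
      _ ≤ _ := Finset.sum_le_sum (fun v hv => by
        obtain ⟨v2, hv2, h3⟩ := low_count h u hd v (by simpa using hv)
        refine h3.trans (Finset.card_le_card (Finset.inter_subset_inter_left ?_))
        exact Finset.subset_biUnion_of_mem (nb (op R)) hv2)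
  have e3 : k * (U1ᶜ).card ≤ ∑ v ∈ Pᶜ, (nb (op R) v ∩ U1ᶜ).card := by
    rw [← double_count]
    calc k * (U1ᶜ).card = ∑ w ∈ U1ᶜ, k := by simp [mul_comm]
      _ ≤ _ := Finset.sum_le_sum (fun w hw => by
        have : nb R w ∩ Pᶜ = nb R w := by
          apply Finset.inter_eq_left.mpr
          intro v hv
          rw [Finset.mem_compl]
          intro hvP
          apply Finset.mem_compl.mp hw
          exact Finset.mem_biUnion.mpr ⟨v, hvP, mem_nb_op.mpr (mem_nb.mp hv)⟩
        rw [this]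
        exact hk w)
  omega

lemma deg_ge_two {n : ℕ} {R : Fin n → Fin n → Prop} (h : Sat R)
    (he : ∑ u, (nb R u).card + 5 ≤ 4 * n) (u : Fin n) : 2 ≤ (nb R u).card := by
  by_contra hc
  have h1 : (nb R u).card = 1 := by have := deg_pos h u; omega
  have h2 := low_sum h u (by omega) 1 (deg_pos h)
  rw [edge_count, ← Finset.sum_add_sum_compl (nb R u)] at he
  obtain ⟨a, ha⟩ := Finset.card_eq_one.mp h1
  rw [ha] at he h2
  simp only [Finset.sum_singleton, Finset.singleton_biUnion, Finset.card_singleton] at he h2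
  have := Finset.card_add_card_compl (nb (op R) a)
  simp only [Fintype.card_fin] at this
  omega

lemma deg_ge_three {n : ℕ} {R : Fin n → Fin n → Prop} (h : Sat R)
    (he : ∑ u, (nb R u).card + 5 ≤ 4 * n) (u : Fin n) : 3 ≤ (nb R u).card := by
  by_contra hc
  have hd1 := deg_ge_two h he
  have hd2 := deg_ge_two h.swap (by rw [← edge_count]; exact he)
  have h1 : (nb R u).card = 2 := by have := hd1 u; omega
  have h2 := low_sum h u (by omega) 2 hd1
  have hlow := low_count h u (by omega)
  rw [edge_count, ← Finset.sum_add_sum_compl (nb R u)] at he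
  obtain ⟨a, b, hab, hP⟩ := Finset.card_eq_two.mp h1
  have hua : R u a := mem_nb.mp (by rw [hP]; simp)
  have hub : R u b := mem_nb.mp (by rw [hP]; simp)
  rw [h1] at h2
  rw [hP] at he h2
  rw [Finset.sum_pair hab] at he
  have hU : (({a, b} : Finset (Fin n)).biUnion (nb (op R))) = nb (op R) a ∪ nb (op R) b := by
    ext; simp
  rw [hU] at h2
  have h3 := Finset.card_union_add_card_inter (nb (op R) a) (nb (op R) b)
  have h4 := Finset.card_add_card_compl (nb (op R) a ∪ nb (op R) b)
  simp only [Fintype.card_fin] at h4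
  have h5 : 1 ≤ (nb (op R) a ∩ nb (op R) b).card :=
    Finset.card_pos.mpr ⟨u, by simp [mem_nb_op, hua, hub]⟩
  have h6 : (nb (op R) a ∩ nb (op R) b).card = 1 := by omega
  have hint : ∀ w, R w a → R w b → w = u := by
    intro w hwa hwb
    exact (Finset.card_le_one.mp h6.le) w (by simp [mem_nb_op, hwa, hwb]) u
      (by simp [mem_nb_op, hua, hub])
  have hsum : ∑ v ∈ ({a, b} : Finset (Fin n))ᶜ, (nb (op R) v).card = 3 * (n - 2) := by omega
  have hge : ∀ v ∈ ({a, b} : Finset (Fin n))ᶜ, 3 ≤ (nb (op R) v).card := by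
    intro v hv
    obtain ⟨v2, _, h3⟩ := hlow v (by rw [hP]; simpa using hv)
    exact h3.trans (Finset.card_le_card Finset.inter_subset_left)
  have hcc : (({a, b} : Finset (Fin n))ᶜ).card = n - 2 := by
    rw [Finset.card_compl, Finset.card_pair hab, Fintype.card_fin]
  have heq : ∀ v ∈ ({a, b} : Finset (Fin n))ᶜ, 3 = (nb (op R) v).card := by
    apply (Finset.sum_eq_sum_iff_of_le hge).mp
    rw [hsum, Finset.sum_const, hcc, smul_eq_mul, mul_comm]
  -- every other vertex is dominated by a or by b
  have hdom : ∀ v, v ≠ a → v ≠ b → nb (op R) v ⊆ nb (op R) a ∨ nb (op R) v ⊆ nb (op R) b := by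
    intro v hva hvb
    have hm : v ∈ ({a, b} : Finset (Fin n))ᶜ := by simp [hva, hvb]
    obtain ⟨v2, hv2, h3⟩ := hlow v (by rw [hP]; simpa using hm)
    have : nb (op R) v ⊆ nb (op R) v2 := by
      apply Finset.inter_eq_left.mp
      exact Finset.eq_of_subset_of_card_le Finset.inter_subset_left (by rw [← heq v hm]; exact h3)
    rw [hP] at hv2
    simp only [Finset.mem_insert, Finset.mem_singleton] at hv2
    rcases hv2 with rfl | rfl
    · exact Or.inl this
    · exact Or.inr this
  obtain ⟨w, hw, hwu⟩ := Finset.exists_mem_ne (by have := hd2 a; omega : 1 < (nb (op R) a).card) u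
  have hwa : R w a := mem_nb_op.mp hw
  have hwb : ¬ R w b := fun hh => hwu (hint w hwa hh)
  rcases h.sat w b hwb with ⟨u2, hu2, hc3⟩ | ⟨v2, hv2, hc3⟩
  · have hu2u : u2 ≠ u := by
      rintro rfl
      have := Finset.card_le_card (Finset.inter_subset_right (s₁ := nb R w) (s₂ := nb R u2))
      omega
    have hu2a : ¬ R u2 a := fun hh => hu2u (hint u2 hh hu2)
    obtain ⟨v, hv⟩ := Finset.card_pos.mp (by omega : 0 < (nb R w ∩ nb R u2).card)
    rw [Finset.mem_inter, mem_nb, mem_nb] at hv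
    have hva : v ≠ a := by rintro rfl; exact hu2a hv.2
    have hvb : v ≠ b := by rintro rfl; exact hwb hv.1
    rcases hdom v hva hvb with hh | hh
    · exact hu2a (mem_nb_op.mp (hh (mem_nb_op.mpr hv.2)))
    · exact hwb (mem_nb_op.mp (hh (mem_nb_op.mpr hv.1)))
  · have hva : v2 ≠ a := by
      rintro rfl
      rw [Finset.inter_comm] at hc3
      omega
    have hvb : v2 ≠ b := by rintro rfl; exact hwb hv2
    have hm : v2 ∈ ({a, b} : Finset (Fin n))ᶜ := by simp [hva, hvb]
    have : nb (op R) v2 ⊆ nb (op R) b := by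
      apply Finset.inter_eq_right.mp
      exact Finset.eq_of_subset_of_card_le Finset.inter_subset_right
        (by rw [← heq v2 hm]; exact hc3)
    exact hwb (mem_nb_op.mp (this (mem_nb_op.mpr hv2)))

lemma sat_of_saturated {n : ℕ} {E : Finset (Fin n × Fin n)} (h : SaturatedKst n E 2 4) :
    Sat (fun u v => (u, v) ∈ E) where
  free1 := by
    intro u u' huu
    by_contra hc
    obtain ⟨T, hT, hTc⟩ := Finset.exists_subset_card_eq (by omega :
      4 ≤ (nb (fun u v => (u, v) ∈ E) u ∩ nb (fun u v => (u, v) ∈ E) u').card)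
    refine h.1 (Or.inl ⟨{u, u'}, T, Finset.card_pair huu, hTc, ?_⟩)
    intro a ha v hv
    have := hT hv
    rw [Finset.mem_inter, mem_nb, mem_nb] at this
    simp only [Finset.mem_insert, Finset.mem_singleton] at ha
    rcases ha with rfl | rfl
    · exact this.1
    · exact this.2
  free2 := by
    intro u u' huu
    by_contra hc
    obtain ⟨T, hT, hTc⟩ := Finset.exists_subset_card_eq (by omega :
      4 ≤ (nb (op fun u v => (u, v) ∈ E) u ∩ nb (op fun u v => (u, v) ∈ E) u').card)
    refine h.1 (Or.inr ⟨T, {u, u'}, hTc, Finset.card_pair huu, ?_⟩)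
    intro v hv a ha
    have := hT hv
    rw [Finset.mem_inter, mem_nb_op, mem_nb_op] at this
    simp only [Finset.mem_insert, Finset.mem_singleton] at ha
    rcases ha with rfl | rfl
    · exact this.1
    · exact this.2
  sat := by
    intro u v huv
    have key : ∀ S T : Finset (Fin n), (∀ a ∈ S, ∀ b ∈ T, (a, b) ∈ insert (u, v) E) →
        (¬ ∀ a ∈ S, ∀ b ∈ T, (a, b) ∈ E) → u ∈ S ∧ v ∈ T := by
      intro S T h1 h2
      push Not at h2
      obtain ⟨a, ha, b, hb, hab⟩ := h2
      have := h1 a ha b hb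
      rw [Finset.mem_insert] at this
      rcases this with h3 | h3
      · simp only [Prod.mk.injEq] at h3
        exact ⟨h3.1 ▸ ha, h3.2 ▸ hb⟩
      · exact absurd h3 hab
    rcases h.2 u v huv with ⟨S, T, hS, hT, hST⟩ | ⟨S, T, hS, hT, hST⟩
    · obtain ⟨huS, hvT⟩ := key S T hST (fun hh => h.1 (Or.inl ⟨S, T, hS, hT, hh⟩))
      obtain ⟨u2, hu2, hne⟩ := Finset.exists_mem_ne (by omega : 1 < S.card) u
      left
      refine ⟨u2, ?_, ?_⟩
      · have := hST u2 hu2 v hvT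
        simpa [hne] using this
      · have h3 : (T.erase v).card = 3 := by rw [Finset.card_erase_of_mem hvT, hT]
        rw [← h3]
        apply Finset.card_le_card
        intro b hb
        rw [Finset.mem_erase] at hb
        have q1 := hST u huS b hb.2
        have q2 := hST u2 hu2 b hb.2
        simp only [Finset.mem_insert, Prod.mk.injEq, hb.1, and_false, false_or] at q1 q2
        simp [mem_nb, q1, q2]
    · obtain ⟨huS, hvT⟩ := key S T hST (fun hh => h.1 (Or.inr ⟨S, T, hS, hT, hh⟩))
      obtain ⟨v2, hv2, hne⟩ := Finset.exists_mem_ne (by omega : 1 < T.card) v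
      right
      refine ⟨v2, ?_, ?_⟩
      · have := hST u huS v2 hv2
        simpa [hne] using this
      · have h3 : (S.erase u).card = 3 := by rw [Finset.card_erase_of_mem huS, hS]
        rw [← h3]
        apply Finset.card_le_card
        intro b hb
        rw [Finset.mem_erase] at hb
        have q1 := hST b hb.2 v hvT
        have q2 := hST b hb.2 v2 hv2
        simp only [Finset.mem_insert, Prod.mk.injEq, hb.1, false_and, false_or] at q1 q2
        simp [mem_nb_op, q1, q2]

lemma card_edges {n : ℕ} (E : Finset (Fin n × Fin n)) :
    E.card = ∑ u, (nb (fun u v => (u, v) ∈ E) u).card := by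
  rw [Finset.card_eq_sum_card_fiberwise (f := Prod.fst) (t := univ) (by simp)]
  refine Finset.sum_congr rfl (fun u _ => ?_)
  refine Finset.card_bij' (fun p _ => p.2) (fun v _ => (u, v)) ?_ ?_ ?_ ?_
  · rintro ⟨a, b⟩ hp
    simp only [Finset.mem_filter] at hp
    rw [mem_nb]; obtain ⟨h1, rfl⟩ := hp; exact h1
  · intro v hv
    rw [mem_nb] at hv
    simp [hv]
  · rintro ⟨a, b⟩ hp
    simp only [Finset.mem_filter] at hp
    simp [hp.2]
  · simp

/-- Successor on the cycle `2, 3, …, n - 1`. -/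
def nx (n : ℕ) (i : ℕ) : ℕ := if i + 1 = n then 2 else i + 1

/-- Predecessor on the cycle `2, 3, …, n - 1`. -/
def pv (n : ℕ) (i : ℕ) : ℕ := if i = 2 then n - 1 else i - 1

/-- The adjacency of the extremal graph. -/
def exR (n : ℕ) (u v : Fin n) : Prop :=
  u.val = 0 ∨ v.val = 0 ∨ u = v ∨ (2 ≤ u.val ∧ v.val = nx n u.val)

lemma nb_exR {n : ℕ} (hn : 4 ≤ n) (u : Fin n) :
    (u.val = 0 → (nb (exR n) u).card = n) ∧ (u.val = 1 → (nb (exR n) u).card = 2) ∧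
    (2 ≤ u.val → (nb (exR n) u).card = 3) := by
  refine ⟨?_, ?_, ?_⟩
  · intro h0
    have : nb (exR n) u = univ := by ext v; simp [mem_nb, exR, h0]
    simp [this]
  · intro h1
    have : nb (exR n) u = {⟨0, by omega⟩, u} := by
      ext v; simp [mem_nb, exR, h1, Fin.ext_iff, eq_comm]
    rw [this, Finset.card_pair]
    simp [Fin.ext_iff, h1]
  · intro h2
    have hlt : nx n u.val < n := by have := u.2; unfold nx; split_ifs <;> omega
    have hne : nx n u.val ≠ u.val ∧ nx n u.val ≠ 0 := by
      have := u.2; unfold nx; split_ifs <;> omega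
    have : nb (exR n) u = {⟨0, by omega⟩, u, ⟨nx n u.val, hlt⟩} := by
      ext v; simp only [mem_nb, exR, Fin.ext_iff, Finset.mem_insert, Finset.mem_singleton]; omega
    rw [this, Finset.card_eq_three]
    refine ⟨_, _, _, ?_, ?_, ?_, rfl⟩ <;> simp only [ne_eq, Fin.ext_iff] <;> omega

lemma nb_op_exR {n : ℕ} (hn : 4 ≤ n) (u : Fin n) :
    (u.val = 1 → (nb (op (exR n)) u).card = 2) ∧
    (2 ≤ u.val → (nb (op (exR n)) u).card = 3) := by
  refine ⟨?_, ?_⟩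
  · intro h1
    have : nb (op (exR n)) u = {⟨0, by omega⟩, u} := by
      ext v
      have := v.2
      simp only [mem_nb_op, exR, Fin.ext_iff, Finset.mem_insert, Finset.mem_singleton, nx]
      split_ifs <;> omega
    rw [this, Finset.card_pair]
    simp [Fin.ext_iff, h1]
  · intro h2
    have hlt : pv n u.val < n := by have := u.2; unfold pv; split_ifs <;> omega
    have hne : pv n u.val ≠ u.val ∧ pv n u.val ≠ 0 := by
      have := u.2; unfold pv; split_ifs <;> omega
    have : nb (op (exR n)) u = {⟨0, by omega⟩, u, ⟨pv n u.val, hlt⟩} := by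
      ext v
      have := v.2
      have := u.2
      simp only [mem_nb_op, exR, Fin.ext_iff, Finset.mem_insert, Finset.mem_singleton, nx, pv]
      split_ifs <;> omega
    rw [this, Finset.card_eq_three]
    refine ⟨_, _, _, ?_, ?_, ?_, rfl⟩ <;> simp only [ne_eq, Fin.ext_iff] <;> omega

lemma exR_card {n : ℕ} (hn : 4 ≤ n) : ∑ u, (nb (exR n) u).card = 4 * n - 4 := by
  obtain ⟨m, rfl⟩ : ∃ m, n = m + 2 := ⟨n - 2, by omega⟩
  rw [Fin.sum_univ_succ, Fin.sum_univ_succ]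
  rw [(nb_exR hn _).1 (by simp), (nb_exR hn _).2.1 (by simp)]
  rw [Finset.sum_congr rfl (fun i _ => (nb_exR hn _).2.2 (by simp))]
  simp
  omega

open Classical in
lemma exists_extremal {n : ℕ} (hn : 4 ≤ n) :
    ∃ E : Finset (Fin n × Fin n), SaturatedKst n E 2 4 ∧ E.card = 4 * n - 4 := by
  refine ⟨univ.filter (fun p => exR n p.1 p.2), ⟨?_, ?_⟩, ?_⟩
  · rintro (⟨S, T, hS, hT, hST⟩ | ⟨S, T, hS, hT, hST⟩)
    · obtain ⟨u, hu, hne⟩ := Finset.exists_mem_ne (by omega : 1 < S.card) ⟨0, by omega⟩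
      have hle : T.card ≤ (nb (exR n) u).card := Finset.card_le_card (fun v hv => by
        have := hST u hu v hv
        simpa [mem_nb] using this)
      have h0 : u.val ≠ 0 := fun hh => hne (Fin.ext hh)
      rcases (by omega : u.val = 1 ∨ 2 ≤ u.val) with h1 | h1
      · rw [(nb_exR hn u).2.1 h1] at hle; omega
      · rw [(nb_exR hn u).2.2 h1] at hle; omega
    · obtain ⟨v, hv, hne⟩ := Finset.exists_mem_ne (by omega : 1 < T.card) ⟨0, by omega⟩
      have hle : S.card ≤ (nb (op (exR n)) v).card := Finset.card_le_card (fun u hu => by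
        have := hST u hu v hv
        simpa [mem_nb_op] using this)
      have h0 : v.val ≠ 0 := fun hh => hne (Fin.ext hh)
      rcases (by omega : v.val = 1 ∨ 2 ≤ v.val) with h1 | h1
      · rw [(nb_op_exR hn v).1 h1] at hle; omega
      · rw [(nb_op_exR hn v).2 h1] at hle; omega
  · intro u v huv
    have hR : ¬ exR n u v := by simpa using huv
    have hu0 : u.val ≠ 0 := fun hh => hR (Or.inl hh)
    have hv0 : v.val ≠ 0 := fun hh => hR (Or.inr (Or.inl hh))
    have huv' : u.val ≠ v.val := fun hh => hR (Or.inr (Or.inr (Or.inl (Fin.ext hh))))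
    rcases (by omega : u.val = 1 ∨ 2 ≤ u.val) with h1 | h1
    · right
      refine ⟨insert u (nb (op (exR n)) v), {v, ⟨0, by omega⟩}, ?_, ?_, ?_⟩
      · rw [Finset.card_insert_of_notMem (by simpa [mem_nb_op] using hR),
          (nb_op_exR hn v).2 (by omega)]
      · rw [Finset.card_pair]; simp [Fin.ext_iff, hv0]
      · intro a ha b hb
        simp only [Finset.mem_insert, Finset.mem_singleton, mem_nb_op] at ha hb
        rcases hb with rfl | rfl
        · rcases ha with rfl | ha
          · simp
          · simp [ha]
        · exact Finset.mem_insert_of_mem (Finset.mem_filter.mpr ⟨Finset.mem_univ _, by simp [exR]⟩)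
    · left
      refine ⟨{u, ⟨0, by omega⟩}, insert v (nb (exR n) u), ?_, ?_, ?_⟩
      · rw [Finset.card_pair]; simp [Fin.ext_iff, hu0]
      · rw [Finset.card_insert_of_notMem (by simpa [mem_nb] using hR),
          (nb_exR hn u).2.2 h1]
      · intro b hb a ha
        simp only [Finset.mem_insert, Finset.mem_singleton, mem_nb] at ha hb
        rcases hb with rfl | rfl
        · rcases ha with rfl | ha
          · simp
          · simp [ha]
        · exact Finset.mem_insert_of_mem (Finset.mem_filter.mpr ⟨Finset.mem_univ _, by simp [exR]⟩)
  · rw [card_edges, ← exR_card hn]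
    refine Finset.sum_congr rfl (fun u _ => ?_)
    congr 1
    ext v
    simp [mem_nb]

open Classical in
/-- The main counting argument: a degree three vertex `x` that is dominated. -/
lemma main_count {n : ℕ} {R : Fin n → Fin n → Prop} (h : Sat R)
    (he : ∑ u, (nb R u).card + 5 ≤ 4 * n)
    (hd1 : ∀ u, 3 ≤ (nb R u).card) (hd2 : ∀ v, 3 ≤ (nb (op R) v).card)
    (x : Fin n) (hx : (nb R x).card = 3)
    (h0 : Fin n) (h0x : h0 ≠ x) (h0P : nb R x ⊆ nb R h0) : False := by
  set N := nb R with hN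
  set M := nb (op R) with hM
  have mN : ∀ {u v}, v ∈ N u ↔ R u v := mem_nb
  have mM : ∀ {u v}, u ∈ M v ↔ R u v := mem_nb_op
  set P := N x with hP
  set H : Finset (Fin n) := univ.filter (fun u => u ≠ x ∧ P ⊆ N u) with hH
  have mH : ∀ {u}, u ∈ H ↔ u ≠ x ∧ P ⊆ N u := by intro u; simp [hH]
  have h0H : h0 ∈ H := mH.mpr ⟨h0x, h0P⟩
  set Y1 := H.biUnion N with hY1
  have mY1 : ∀ {v}, v ∈ Y1 ↔ ∃ u ∈ H, R u v := by intro v; simp [hY1, mN]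
  have hPY1 : P ⊆ Y1 := fun v hv => mY1.mpr ⟨h0, h0H, mN.mp (h0P hv)⟩
  set G : Finset (Fin n) := Hᶜ.filter (fun z => 3 ≤ (N z ∩ Y1).card) with hG
  set Z : Finset (Fin n) := Hᶜ.filter (fun z => ¬ 3 ≤ (N z ∩ Y1).card) with hZ
  have mG : ∀ {z}, z ∈ G ↔ z ∉ H ∧ 3 ≤ (N z ∩ Y1).card := by intro z; simp [hG]
  have mZ : ∀ {z}, z ∈ Z ↔ z ∉ H ∧ ¬ 3 ≤ (N z ∩ Y1).card := by intro z; simp [hZ]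
  set BY : Finset (Fin n) := Y1ᶜ.filter (fun y => ∀ z ∈ G, ¬ R z y) with hBY
  have mBY : ∀ {y}, y ∈ BY ↔ y ∉ Y1 ∧ ∀ z ∈ G, ¬ R z y := by intro y; simp [hBY]
  -- Part A
  have partA : ∑ z ∈ Z, (N z).card + 2 ≤ 3 * Z.card + BY.card := by
    have s1 : ∑ u, (N u).card = ∑ u ∈ H, (N u).card
        + (∑ u ∈ G, (N u).card + ∑ u ∈ Z, (N u).card) := by
      rw [← Finset.sum_add_sum_compl H, hG, hZ, Finset.sum_filter_add_sum_filter_not]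
    have c1 : H.card + (G.card + Z.card) = n := by
      rw [hG, hZ, Finset.card_filter_add_card_filter_not, Finset.card_add_card_compl,
        Fintype.card_fin]
    have s2 : Y1.card + 3 * H.card ≤ ∑ u ∈ H, (N u).card + 3 := by
      have t1 : ∑ u ∈ H, (N u).card = ∑ u ∈ H, ((N u \ P).card + 3) := by
        refine Finset.sum_congr rfl (fun u hu => ?_)
        rw [← hx]
        exact (Finset.card_sdiff_add_card_eq_card (mH.mp hu).2).symm
      rw [t1, Finset.sum_add_distrib, Finset.sum_const, smul_eq_mul]
      have t2 : (Y1 \ P).card ≤ ∑ u ∈ H, (N u \ P).card := by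
        have : Y1 \ P = H.biUnion (fun u => N u \ P) := by
          ext v
          simp only [hY1, Finset.mem_sdiff, Finset.mem_biUnion]
          tauto
        rw [this]
        exact Finset.card_biUnion_le
      have t3 := Finset.card_sdiff_add_card_eq_card hPY1
      omega
    have s3 : 3 * G.card + (Y1ᶜ \ BY).card ≤ ∑ u ∈ G, (N u).card := by
      have t1 : (Y1ᶜ \ BY).card ≤ ∑ u ∈ G, (N u ∩ (Y1ᶜ \ BY)).card := by
        apply cover_count (op R)
        intro y hy
        rw [Finset.mem_sdiff, mBY, Finset.mem_compl] at hy
        obtain ⟨hy1, hy2⟩ := hy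
        push Not at hy2
        exact hy2 hy1
      have t2 : ∑ u ∈ G, (3 + (N u ∩ (Y1ᶜ \ BY)).card) ≤ ∑ u ∈ G, (N u).card := by
        refine Finset.sum_le_sum (fun u hu => ?_)
        have q1 := (mG.mp hu).2
        have q2 := card_inter_compl_add (N u) Y1
        have q3 : (N u ∩ (Y1ᶜ \ BY)).card ≤ (N u ∩ Y1ᶜ).card :=
          Finset.card_le_card (Finset.inter_subset_inter_left Finset.sdiff_subset)
        omega
      rw [Finset.sum_add_distrib, Finset.sum_const, smul_eq_mul] at t2
      omega
    have c2 : (Y1ᶜ \ BY).card + BY.card = (Y1ᶜ).card :=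
      Finset.card_sdiff_add_card_eq_card (Finset.filter_subset _ _)
    have c3 := Finset.card_add_card_compl Y1
    rw [Fintype.card_fin] at c3
    omega
  have hZ3 : 3 * Z.card ≤ ∑ z ∈ Z, (N z).card := by
    calc 3 * Z.card = ∑ z ∈ Z, 3 := by simp [mul_comm]
      _ ≤ _ := Finset.sum_le_sum (fun z _ => hd1 z)
  obtain ⟨y0, hy0⟩ : BY.Nonempty := by
    rw [← Finset.card_pos]; omega
  -- Part B
  set U1 := P.biUnion M with hU1
  have mU1 : ∀ {u}, u ∈ U1 ↔ ∃ p ∈ P, R u p := by intro u; simp [hU1, mM]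
  have hHU1 : H ⊆ U1 := by
    intro u hu
    obtain ⟨p, hp⟩ := Finset.card_pos.mp (by omega : 0 < P.card)
    exact mU1.mpr ⟨p, hp, mN.mp ((mH.mp hu).2 hp)⟩
  have hxU1 : x ∈ U1 := by
    obtain ⟨p, hp⟩ := Finset.card_pos.mp (by omega : 0 < P.card)
    exact mU1.mpr ⟨p, hp, mN.mp hp⟩
  set V3 : Finset (Fin n) := Pᶜ.filter (fun v => 3 ≤ (M v ∩ U1).card) with hV3
  set V2 : Finset (Fin n) := Pᶜ.filter (fun v => ¬ 3 ≤ (M v ∩ U1).card) with hV2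
  have mV3 : ∀ {v}, v ∈ V3 ↔ v ∉ P ∧ 3 ≤ (M v ∩ U1).card := by intro v; simp [hV3]
  have mV2 : ∀ {v}, v ∈ V2 ↔ v ∉ P ∧ ¬ 3 ≤ (M v ∩ U1).card := by intro v; simp [hV2]
  have hMU : ∀ p ∈ P, M p ⊆ U1 := fun p hp => Finset.subset_biUnion_of_mem M hp
  have hY0V3 : ∀ v, v ∉ Y1 → v ∈ V3 := by
    intro v hv
    have hvP : v ∉ P := fun hh => hv (hPY1 hh)
    rcases h.sat x v (fun hh => hvP (mN.mpr hh)) with ⟨u2, hu2, h3⟩ | ⟨v2, hv2, h3⟩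
    · exfalso
      apply hv
      refine mY1.mpr ⟨u2, mH.mpr ⟨?_, ?_⟩, hu2⟩
      · rintro rfl; exact hvP (mN.mpr hu2)
      · apply Finset.inter_eq_left.mp
        exact Finset.eq_of_subset_of_card_le Finset.inter_subset_left (by rw [hx]; exact h3)
    · exact mV3.mpr ⟨hvP, h3.trans
        (Finset.card_le_card (Finset.inter_subset_inter_left (hMU v2 (mN.mpr hv2))))⟩
  set W := U1ᶜ with hW
  set BW : Finset (Fin n) := W.filter (fun w => ∀ v ∈ V3, ¬ R w v) with hBW
  have mBW : ∀ {w}, w ∈ BW ↔ w ∉ U1 ∧ ∀ v ∈ V3, ¬ R w v := by intro w; simp [hBW, hW]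
  have hBWV2 : ∀ w ∈ BW, ∀ v, R w v → v ∈ V2 := by
    intro w hw v hwv
    have q1 : v ∉ P := fun hh => (mBW.mp hw).1 (mU1.mpr ⟨v, hh, hwv⟩)
    have q2 : v ∉ V3 := fun hh => (mBW.mp hw).2 v hh hwv
    exact mV2.mpr ⟨q1, fun hh => q2 (mV3.mpr ⟨q1, hh⟩)⟩
  have hV2Y1 : ∀ v ∈ V2, v ∈ Y1 := by
    intro v hv
    by_contra hc
    exact (mV2.mp hv).2 (mV3.mp (hY0V3 v hc)).2
  set V4 : Finset (Fin n) := V3.filter (fun v => 4 ≤ (M v ∩ U1).card) with hV4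
  set D : Finset (Fin n) := U1.filter (fun u => u ∉ insert x H ∧ 2 ≤ (N u ∩ P).card) with hD
  have hDs : D ⊆ U1 := Finset.filter_subset _ _
  have hV4s : V4 ⊆ V3 := Finset.filter_subset _ _
  have sP : U1.card + 2 * (H.card + 1) + D.card ≤ ∑ v ∈ P, (M v).card := by
    have t1 : ∑ v ∈ P, (M v).card = ∑ u ∈ U1, (N u ∩ P).card := by
      rw [hN, double_count]
      refine Finset.sum_congr rfl (fun v hv => ?_)
      rw [Finset.inter_eq_left.mpr (hMU v hv)]
    have t2 : ∑ u ∈ U1, (1 + (if u ∈ insert x H then 2 else 0) + (if u ∈ D then 1 else 0))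
        ≤ ∑ u ∈ U1, (N u ∩ P).card := by
      refine Finset.sum_le_sum (fun u hu => ?_)
      by_cases hk : u ∈ insert x H
      · have hPu : P ⊆ N u := by
          rcases Finset.mem_insert.mp hk with rfl | hk'
          · exact subset_rfl
          · exact (mH.mp hk').2
        have hnD : u ∉ D := by
          intro hh
          rw [hD, Finset.mem_filter] at hh
          exact hh.2.1 hk
        rw [Finset.inter_eq_right.mpr hPu, hx, if_pos hk, if_neg hnD]
      · rw [if_neg hk]
        obtain ⟨p, hp, hup⟩ := mU1.mp hu
        have : 0 < (N u ∩ P).card :=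
          Finset.card_pos.mpr ⟨p, Finset.mem_inter.mpr ⟨mN.mpr hup, hp⟩⟩
        split_ifs with hh
        · rw [hD, Finset.mem_filter] at hh
          exact hh.2.2
        · omega
    have hsub : insert x H ⊆ U1 := Finset.insert_subset hxU1 hHU1
    have hxH : x ∉ H := fun hh => (mH.mp hh).1 rfl
    have t3 : ∑ u ∈ U1, (1 + (if u ∈ insert x H then 2 else 0) + (if u ∈ D then 1 else 0))
        = U1.card + 2 * (H.card + 1) + D.card := by
      rw [Finset.sum_add_distrib, Finset.sum_add_distrib, Finset.sum_ite_mem, Finset.sum_ite_mem,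
        Finset.inter_eq_right.mpr hsub, Finset.inter_eq_right.mpr hDs,
        Finset.sum_const, Finset.sum_const, Finset.sum_const, Finset.card_insert_of_notMem hxH]
      simp only [smul_eq_mul]
      omega
    omega
  have sV3 : 3 * V3.card + (W \ BW).card + V4.card ≤ ∑ v ∈ V3, (M v).card := by
    have t1 : (W \ BW).card ≤ ∑ v ∈ V3, (M v ∩ (W \ BW)).card := by
      apply cover_count R
      intro w hw
      rw [Finset.mem_sdiff, mBW, hW, Finset.mem_compl] at hw
      obtain ⟨hw1, hw2⟩ := hw
      push Not at hw2
      exact hw2 hw1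
    have t2 : ∑ v ∈ V3, (3 + (M v ∩ (W \ BW)).card + (if v ∈ V4 then 1 else 0))
        ≤ ∑ v ∈ V3, (M v).card := by
      refine Finset.sum_le_sum (fun v hv => ?_)
      have q1 := (mV3.mp hv).2
      have q2 := card_inter_compl_add (M v) U1
      rw [← hW] at q2
      have q3 : (M v ∩ (W \ BW)).card ≤ (M v ∩ W).card :=
        Finset.card_le_card (Finset.inter_subset_inter_left Finset.sdiff_subset)
      split_ifs with hh
      · rw [hV4, Finset.mem_filter] at hh
        omega
      · omega
    rw [Finset.sum_add_distrib, Finset.sum_add_distrib, Finset.sum_ite_mem,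
      Finset.inter_eq_right.mpr hV4s, Finset.sum_const, Finset.sum_const,
      smul_eq_mul, smul_eq_mul] at t2
    omega
  have sV2 : 3 * V2.card + BW.card ≤ ∑ v ∈ V2, (M v).card := by
    set VS : Finset (Fin n) := V2.filter (fun v => 3 + (M v ∩ BW).card ≤ (M v).card) with hVS
    have hVSs : VS ⊆ V2 := Finset.filter_subset _ _
    have t1 : BW.card ≤ ∑ v ∈ VS, (M v ∩ BW).card := by
      apply cover_count R
      intro w hw
      have hy0' := mBY.mp hy0
      have hwy : ¬ R w y0 := (mBW.mp hw).2 y0 (hY0V3 y0 hy0'.1)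
      rcases h.sat w y0 hwy with ⟨u2, hu2, h3⟩ | ⟨v2, hv2, h3⟩
      · exfalso
        apply hy0'.2 u2 _ hu2
        refine mG.mpr ⟨fun hh => hy0'.1 (mY1.mpr ⟨u2, hh, hu2⟩), h3.trans ?_⟩
        apply Finset.card_le_card
        intro v hv
        rw [Finset.mem_inter] at hv ⊢
        exact ⟨hv.2, hV2Y1 v (hBWV2 w hw v (mN.mp hv.1))⟩
      · refine ⟨v2, ?_, hv2⟩
        rw [hVS, Finset.mem_filter]
        refine ⟨hBWV2 w hw v2 hv2, ?_⟩
        have hdisj : Disjoint (M y0 ∩ M v2) (M v2 ∩ BW) := by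
          rw [Finset.disjoint_left]
          intro a ha hb
          rw [Finset.mem_inter] at ha hb
          exact (mBW.mp hb.2).2 y0 (hY0V3 y0 hy0'.1) (mM.mp ha.1)
        have hle := Finset.card_le_card (Finset.union_subset
          (Finset.inter_subset_right (s₁ := M y0) (s₂ := M v2))
          (Finset.inter_subset_left (s₁ := M v2) (s₂ := BW)))
        rw [Finset.card_union_of_disjoint hdisj] at hle
        have h3' : 3 ≤ (M y0 ∩ M v2).card := h3
        omega
    have t2 : ∑ v ∈ V2, (3 + (if v ∈ VS then (M v ∩ BW).card else 0))
        ≤ ∑ v ∈ V2, (M v).card := by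
      refine Finset.sum_le_sum (fun v hv => ?_)
      split_ifs with hh
      · rw [hVS, Finset.mem_filter] at hh
        exact hh.2
      · exact hd2 v
    rw [Finset.sum_add_distrib, Finset.sum_ite_mem,
      Finset.inter_eq_right.mpr hVSs, Finset.sum_const,
      smul_eq_mul] at t2
    omega
  have partB : H.card = 1 ∧ D.card = 0 ∧ V4.card = 0 := by
    have s1 : ∑ v, (M v).card = ∑ v ∈ P, (M v).card
        + (∑ v ∈ V3, (M v).card + ∑ v ∈ V2, (M v).card) := by
      rw [← Finset.sum_add_sum_compl P, hV3, hV2, Finset.sum_filter_add_sum_filter_not]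
    have c1 : P.card + (V3.card + V2.card) = n := by
      rw [hV3, hV2, Finset.card_filter_add_card_filter_not, Finset.card_add_card_compl,
        Fintype.card_fin]
    have c2 : (W \ BW).card + BW.card = W.card :=
      Finset.card_sdiff_add_card_eq_card (Finset.filter_subset _ _)
    have c3 := Finset.card_add_card_compl U1
    rw [Fintype.card_fin, ← hW] at c3
    have c4 : 0 < H.card := Finset.card_pos.mpr ⟨h0, h0H⟩
    have e1 : ∑ u, (N u).card = ∑ v, (M v).card := edge_count R
    omega
  obtain ⟨hH1, hD0, hV40⟩ := partB
  rw [Finset.card_eq_zero] at hD0 hV40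
  have hone : ∀ u, u ∉ insert x H → ∀ p ∈ P, ∀ q ∈ P, R u p → R u q → p = q := by
    intro u hu p hp q hq hup huq
    by_contra hne
    have : u ∈ D := by
      rw [hD, Finset.mem_filter]
      refine ⟨mU1.mpr ⟨p, hp, hup⟩, hu, ?_⟩
      exact Finset.one_lt_card.mpr ⟨p, Finset.mem_inter.mpr ⟨mN.mpr hup, hp⟩, q,
        Finset.mem_inter.mpr ⟨mN.mpr huq, hq⟩, hne⟩
    simp [hD0] at this
  -- Part C
  have partC : ∀ z ∈ U1, ∀ y ∈ BY, R z y → z ∈ Z ∧ 4 ≤ (N z).card ∧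
      (N z ∩ BY).card + 1 ≤ (N z).card := by
    intro z hz y hy hzy
    obtain ⟨hy1, hy2⟩ := mBY.mp hy
    have hzH : z ∉ H := fun hh => hy1 (mY1.mpr ⟨z, hh, hzy⟩)
    have hzx : z ≠ x := by rintro rfl; exact hy1 (hPY1 (mN.mpr hzy))
    have hzZ : z ∈ Z := mZ.mpr ⟨hzH, fun hh => hy2 z (mG.mpr ⟨hzH, hh⟩) hzy⟩
    obtain ⟨s, hs, hzs⟩ := mU1.mp hz
    have hzK : z ∉ insert x H := by simp [hzx, hzH]
    have hsBY : s ∉ BY := fun hh => (mBY.mp hh).1 (hPY1 hs)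
    refine ⟨hzZ, ?_, ?_⟩
    · obtain ⟨p, hp, hps⟩ := Finset.exists_mem_ne (by omega : 1 < P.card) s
      have hzp : ¬ R z p := fun hh => hps (hone z hzK p hp s hs hh hzs)
      rcases h.sat z p hzp with ⟨u2, hu2, h3⟩ | ⟨v2, hv2, h3⟩
      · have hu2H : u2 ∉ H := by
          intro hh
          apply (mZ.mp hzZ).2
          refine h3.trans (Finset.card_le_card (Finset.inter_subset_inter_left ?_))
          exact Finset.subset_biUnion_of_mem N hh
        have hu2x : u2 ≠ x := by
          rintro rfl
          have : (N z ∩ P).card ≤ 1 := by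
            rw [Finset.card_le_one]
            intro a ha b hb
            rw [Finset.mem_inter] at ha hb
            exact hone z hzK a ha.2 b hb.2 (mN.mp ha.1) (mN.mp hb.1)
          have h3' : 3 ≤ (N z ∩ P).card := h3
          omega
        have hu2K : u2 ∉ insert x H := by simp [hu2x, hu2H]
        have hu2s : ¬ R u2 s := fun hh => hps (hone u2 hu2K p hp s hs hu2 hh)
        have hnot : s ∉ N z ∩ N u2 := by
          rw [Finset.mem_inter, mN, mN]; tauto
        have hsub : insert s (N z ∩ N u2) ⊆ N z :=
          Finset.insert_subset (mN.mpr hzs) Finset.inter_subset_left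
        have hle := Finset.card_le_card hsub
        rw [Finset.card_insert_of_notMem hnot] at hle
        have h3' : 3 ≤ (N z ∩ N u2).card := h3
        omega
      · exfalso
        have h3' : 3 ≤ (M p ∩ M v2).card := h3
        by_cases hvP : v2 ∈ P
        · have hvs : v2 = s := hone z hzK v2 hvP s hs hv2 hzs
          have hsub : M p ∩ M v2 ⊆ insert x H := by
            intro a ha
            rw [Finset.mem_inter, mM, mM] at ha
            by_contra hc
            exact hps ((hone a hc p hp v2 hvP ha.1 ha.2).trans hvs)
          have q1 := Finset.card_le_card hsub
          have q2 := Finset.card_insert_le x H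
          omega
        · have hnot : z ∉ M p ∩ M v2 := by
            rw [Finset.mem_inter, mM, mM]; tauto
          have hsub : insert z (M p ∩ M v2) ⊆ M v2 ∩ U1 := by
            apply Finset.insert_subset
            · exact Finset.mem_inter.mpr ⟨mM.mpr hv2, hz⟩
            · intro a ha
              rw [Finset.mem_inter] at ha ⊢
              exact ⟨ha.2, hMU p hp ha.1⟩
          have hle := Finset.card_le_card hsub
          rw [Finset.card_insert_of_notMem hnot] at hle
          have : v2 ∈ V4 := by
            rw [hV4, Finset.mem_filter]
            exact ⟨mV3.mpr ⟨hvP, by omega⟩, by omega⟩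
          simp [hV40] at this
    · have hnot : s ∉ N z ∩ BY := by
        rw [Finset.mem_inter]; tauto
      have hsub : insert s (N z ∩ BY) ⊆ N z :=
        Finset.insert_subset (mN.mpr hzs) Finset.inter_subset_left
      have hle := Finset.card_le_card hsub
      rwa [Finset.card_insert_of_notMem hnot] at hle
  -- final count
  have f1 : 3 * BY.card ≤ ∑ y ∈ BY, (M y ∩ U1).card := by
    calc 3 * BY.card = ∑ y ∈ BY, 3 := by simp [mul_comm]
      _ ≤ _ := Finset.sum_le_sum (fun y hy => (mV3.mp (hY0V3 y (mBY.mp hy).1)).2)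
  have f2 : ∑ y ∈ BY, (M y ∩ U1).card = ∑ z ∈ U1, (N z ∩ BY).card := (double_count R U1 BY).symm
  have f3 : ∑ z ∈ U1, (N z ∩ BY).card ≤ ∑ z ∈ Z, 3 * ((N z).card - 3) := by
    calc ∑ z ∈ U1, (N z ∩ BY).card
        ≤ ∑ z ∈ U1, (if z ∈ Z then 3 * ((N z).card - 3) else 0) := by
          refine Finset.sum_le_sum (fun z hz => ?_)
          rcases Finset.eq_empty_or_nonempty (N z ∩ BY) with h1 | ⟨y, hy⟩
          · simp [h1]
          · rw [Finset.mem_inter] at hy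
            obtain ⟨q1, q2, q3⟩ := partC z hz y hy.2 (mN.mp hy.1)
            rw [if_pos q1]
            omega
      _ = ∑ z ∈ U1 ∩ Z, 3 * ((N z).card - 3) := by rw [Finset.sum_ite_mem]
      _ ≤ _ := Finset.sum_le_sum_of_subset Finset.inter_subset_right
  have f4 : ∑ z ∈ Z, 3 * ((N z).card - 3) + 9 * Z.card = 3 * ∑ z ∈ Z, (N z).card := by
    rw [Finset.mul_sum]
    have : 9 * Z.card = ∑ z ∈ Z, 9 := by simp [mul_comm]
    rw [this, ← Finset.sum_add_distrib]
    refine Finset.sum_congr rfl (fun z _ => ?_)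
    have := hd1 z
    have h3 : 3 ≤ (N z).card := this
    omega
  omega

open Classical in
lemma many_deg_three {n : ℕ} {R : Fin n → Fin n → Prop}
    (he : ∑ u, (nb R u).card + 5 ≤ 4 * n) (hd : ∀ u, 3 ≤ (nb R u).card) :
    5 ≤ (univ.filter (fun u => (nb R u).card = 3)).card := by
  have h1 : ∑ u : Fin n, 4 ≤ ∑ u, ((nb R u).card + if (nb R u).card = 3 then 1 else 0) := by
    refine Finset.sum_le_sum (fun u _ => ?_)
    have := hd u
    split_ifs <;> omega
  rw [Finset.sum_add_distrib, ← Finset.card_filter] at h1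
  simp at h1
  omega

lemma dominated {n : ℕ} {R : Fin n → Fin n → Prop} (x u : Fin n) (hx : (nb R x).card = 3)
    (h3 : 3 ≤ (nb R x ∩ nb R u).card) : nb R x ⊆ nb R u := by
  apply Finset.inter_eq_left.mp
  exact Finset.eq_of_subset_of_card_le Finset.inter_subset_left (by rw [hx]; exact h3)

open Classical in
theorem lower_bound {n : ℕ} {R : Fin n → Fin n → Prop} (h : Sat R) :
    4 * n ≤ ∑ u, (nb R u).card + 4 := by
  by_contra hc
  have he : ∑ u, (nb R u).card + 5 ≤ 4 * n := by omega
  have he' : ∑ u, (nb (op R) u).card + 5 ≤ 4 * n := by rw [← edge_count]; exact he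
  have hd1 := deg_ge_three h he
  have hd2 := deg_ge_three h.swap he'
  have m1 := many_deg_three he hd1
  have m2 := many_deg_three he' hd2
  obtain ⟨x, hx⟩ := Finset.card_pos.mp (by omega :
    0 < (univ.filter (fun u => (nb R u).card = 3)).card)
  have hx3 : (nb R x).card = 3 := (Finset.mem_filter.mp hx).2
  obtain ⟨y, hy, hyx⟩ := Finset.exists_mem_notMem_of_card_lt_card (by omega : (nb R x).card <
    (univ.filter (fun u => (nb (op R) u).card = 3)).card)
  have hy3 : (nb (op R) y).card = 3 := (Finset.mem_filter.mp hy).2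
  have hxy : ¬ R x y := fun hh => hyx (mem_nb.mpr hh)
  rcases h.sat x y hxy with ⟨u2, hu2, h3⟩ | ⟨v2, hv2, h3⟩
  · exact main_count h he hd1 hd2 x hx3 u2 (by rintro rfl; exact hxy hu2) (dominated x u2 hx3 h3)
  · exact main_count h.swap he' hd2 hd1 y hy3 v2 (by rintro rfl; exact hxy hv2)
      (dominated y v2 hy3 h3)

/-- Proposition 5.1: for all sufficiently large `n`,
`sat(K_{n,n}, K_{2,4}) = 4n - 4`: every `K_{2,4}`-saturated `n` by `n`
bipartite graph has at least `4n - 4` edges, and some such graph has exactly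
`4n - 4` edges. -/
theorem stmt15 :
    ∃ N : ℕ, ∀ n : ℕ, N ≤ n →
      (∀ E : Finset (Fin n × Fin n), SaturatedKst n E 2 4 → 4 * n - 4 ≤ E.card) ∧
      (∃ E : Finset (Fin n × Fin n), SaturatedKst n E 2 4 ∧ E.card = 4 * n - 4) := by

  refine ⟨4, fun n hn => ⟨fun E hE => ?_, exists_extremal hn⟩⟩
  have h1 := lower_bound (sat_of_saturated hE)
  rw [← card_edges] at h1
  omega
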